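/- For every real t with 0.6263716633 − 10⁻¹⁰ < t < 0.6263716633 + 10⁻¹⁰, one has 0.48968967248 < A(t) < 0.48968967363. -/

import Mathlib

noncomputable def A (t : ℝ) : ℝ :=
  (3*t-1)*(t+1)^3*Real.log (t+1)/(16*t^3)
  + (3*t+1)*(1-t)^3*Real.log (2*t+1)/(32*t^3)
  + (1-t)*(185*t^4+698*t^3-217*t^2-160*t+6)/(64*t*(3*t+1)^2*(t+3))

lemma aux_log_lower (y x c : ℝ) (n : ℕ) (h0 : 0 ≤ x) (h1 : x < 1)
    (hy : (1 + x) / (1 - x) ≤ y)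
    (hc : c ≤ 2 * ∑ i ∈ Finset.range n, x ^ (2 * i + 1) / (2 * i + 1)) :
    c ≤ Real.log y := by
  have h := Real.sum_range_le_log_div h0 h1 n
  have h2 : Real.log ((1 + x) / (1 - x)) ≤ Real.log y :=
    Real.log_le_log (div_pos (by linarith) (by linarith)) hy
  linarith

lemma aux_log_upper (y x c : ℝ) (n : ℕ) (h0 : 0 ≤ x) (h1 : x < 1) (hy0 : 0 < y)
    (hy : y ≤ (1 + x) / (1 - x))
    (hc : 2 * ((∑ i ∈ Finset.range n, x ^ (2 * i + 1) / (2 * i + 1))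
      + x ^ (2 * n + 1) / (1 - x ^ 2)) ≤ c) :
    Real.log y ≤ c := by
  have h := Real.log_div_le_sum_range_add h0 h1 n
  have h2 : Real.log y ≤ Real.log ((1 + x) / (1 - x)) :=
    Real.log_le_log hy0 hy
  linarith

theorem A_uniform_bounds : ∀ t : ℝ, 0.6263716633 - 1e-10 < t → t < 0.6263716633 + 1e-10 →
    0.48968967248 < A t ∧ A t < 0.48968967363 := by
  intro t h1 h2
  have l1 : (0.6263716632 : ℝ) ≤ t := by norm_num at h1 ⊢; linarith
  have l2 : t ≤ (0.6263716634 : ℝ) := by norm_num at h2 ⊢; linarith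
  clear h1 h2
  have ht : 0 < t := by norm_num at l1; linarith
  -- logs
  have a1 : (0.48635156015 : ℝ) ≤ Real.log (t + 1) :=
    aux_log_lower _ (0.6263716632 / 2.6263716632) _ 10 (by norm_num) (by norm_num)
      (le_trans (by norm_num) (add_le_add_left l1 1)) (by norm_num [Finset.sum_range_succ])
  have a2 : Real.log (t + 1) ≤ (0.48635156029 : ℝ) :=
    aux_log_upper _ (0.6263716634 / 2.6263716634) _ 10 (by norm_num) (by norm_num) (by linarith)
      (le_trans (add_le_add_left l2 1) (by norm_num)) (by norm_num [Finset.sum_range_succ])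
  have b1 : (0.8121487290 : ℝ) ≤ Real.log (2 * t + 1) :=
    aux_log_lower _ (0.6263716632 / 1.6263716632) _ 12 (by norm_num) (by norm_num)
      (le_trans (by norm_num) (add_le_add_left (mul_le_mul_of_nonneg_left l1 zero_le_two) 1))
      (by norm_num [Finset.sum_range_succ])
  have b2 : Real.log (2 * t + 1) ≤ (0.8121487306 : ℝ) :=
    aux_log_upper _ (0.6263716634 / 1.6263716634) _ 12 (by norm_num) (by norm_num) (by linarith)
      (le_trans (add_le_add_left (mul_le_mul_of_nonneg_left l2 zero_le_two) 1) (by norm_num))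
      (by norm_num [Finset.sum_range_succ])
  -- powers of t
  have p2l : (0.6263716632 : ℝ)^2 ≤ t^2 := by gcongr
  have p2u : t^2 ≤ (0.6263716634 : ℝ)^2 := by gcongr
  have p3l : (0.6263716632 : ℝ)^3 ≤ t^3 := by gcongr
  have p3u : t^3 ≤ (0.6263716634 : ℝ)^3 := by gcongr
  have p4l : (0.6263716632 : ℝ)^4 ≤ t^4 := by gcongr
  have p4u : t^4 ≤ (0.6263716634 : ℝ)^4 := by gcongr
  -- inverse
  have u0 : 0 < t⁻¹ := inv_pos.mpr ht
  have ul : (0.6263716634 : ℝ)⁻¹ ≤ t⁻¹ := by gcongr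
  have uu : t⁻¹ ≤ (0.6263716632 : ℝ)⁻¹ := by gcongr
  have u3l : ((0.6263716634 : ℝ)⁻¹)^3 ≤ t⁻¹^3 := by gcongr
  have u3u : t⁻¹^3 ≤ ((0.6263716632 : ℝ)⁻¹)^3 := by gcongr
  have u2l : ((0.6263716634 : ℝ)⁻¹)^2 ≤ t⁻¹^2 := by gcongr
  have u2u : t⁻¹^2 ≤ ((0.6263716632 : ℝ)⁻¹)^2 := by gcongr
  obtain ⟨c1, hc1⟩ : ∃ c, c = (3*t + 8 + 6*t⁻¹ - t⁻¹^3)/16 := ⟨_, rfl⟩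
  -- (3t+1)(1-t)^3 = -3t^4+8t^3-6t^2+1
  obtain ⟨c2, hc2⟩ : ∃ c, c = (-3*t + 8 - 6*t⁻¹ + t⁻¹^3)/32 := ⟨_, rfl⟩
  obtain ⟨c3, hc3⟩ : ∃ c, c =
    (1-t)*(185*t^4+698*t^3-217*t^2-160*t+6)/(64*t*(3*t+1)^2*(t+3)) := ⟨_, rfl⟩
  have hA : A t = c1 * Real.log (t+1) + c2 * Real.log (2*t+1) + c3 := by
    rw [A, hc1, hc2, hc3]
    congr 1
    congr 1
    · field_simp
      ring
    · field_simp
      ring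
  have c1l : (0.96180890207 : ℝ) ≤ c1 := by
    rw [hc1]; norm_num at *; linarith
  have c1u : c1 ≤ (0.96180890258 : ℝ) := by
    rw [hc1]; norm_num at *; linarith
  have c2l : (0.0190955487 : ℝ) ≤ c2 := by
    rw [hc2]; norm_num at *; linarith
  have c2u : c2 ≤ (0.0190955490 : ℝ) := by
    rw [hc2]; norm_num at *; linarith
  have c3l : (0.00640398698 : ℝ) ≤ c3 := by
    rw [hc3]
    have hP : 185*(0.6263716632 : ℝ)^4+698*(0.6263716632 : ℝ)^3-217*(0.6263716634 : ℝ)^2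
      -160*(0.6263716634 : ℝ)+6 ≤ 185*t^4+698*t^3-217*t^2-160*t+6 := by linarith
    have hQ : 64*t*(3*t+1)^2*(t+3) ≤
      64*(0.6263716634 : ℝ)*(3*(0.6263716634 : ℝ)+1)^2*((0.6263716634 : ℝ)+3) := by gcongr
    have hR : 1 - (0.6263716634 : ℝ) ≤ 1 - t := by linarith
    refine le_trans ?_ (div_le_div₀ ?_ (mul_le_mul hR hP (by norm_num) ?_) (by positivity) hQ)
    · norm_num
    · exact mul_nonneg (le_trans (by norm_num) hR) (le_trans (by norm_num) hP)
    · exact (le_trans (by norm_num) hR)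
  have c3u : c3 ≤ (0.00640398709 : ℝ) := by
    rw [hc3]
    have hP : 185*t^4+698*t^3-217*t^2-160*t+6 ≤
      185*(0.6263716634 : ℝ)^4+698*(0.6263716634 : ℝ)^3-217*(0.6263716632 : ℝ)^2
      -160*(0.6263716632 : ℝ)+6 := by linarith
    have hP' : 185*(0.6263716632 : ℝ)^4+698*(0.6263716632 : ℝ)^3-217*(0.6263716634 : ℝ)^2
      -160*(0.6263716634 : ℝ)+6 ≤ 185*t^4+698*t^3-217*t^2-160*t+6 := by linarith
    have hQ : 64*(0.6263716632 : ℝ)*(3*(0.6263716632 : ℝ)+1)^2*((0.6263716632 : ℝ)+3) ≤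
      64*t*(3*t+1)^2*(t+3) := by gcongr
    have hR : 1 - t ≤ 1 - (0.6263716632 : ℝ) := by linarith
    refine le_trans (div_le_div₀ ?_ (mul_le_mul hR hP (le_trans (by norm_num) hP') ?_)
      (by norm_num) hQ) ?_
    · norm_num
    · norm_num
    · norm_num
  have m1l := mul_le_mul c1l a1 (by norm_num) (le_trans (by norm_num) c1l)
  have m1u := mul_le_mul c1u a2 (le_trans (by norm_num) a1) (by norm_num)
  have m2l := mul_le_mul c2l b1 (by norm_num) (le_trans (by norm_num) c2l)
  have m2u := mul_le_mul c2u b2 (le_trans (by norm_num) b1) (by norm_num)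
  rw [hA]
  clear hA hc1 hc2 hc3
  constructor
  · refine lt_of_lt_of_le ?_ (add_le_add (add_le_add m1l m2l) c3l)
    norm_num
  · refine lt_of_le_of_lt (add_le_add (add_le_add m1u m2u) c3u) ?_
    norm_num
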